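/- Every Nash equilibrium of the Roman domination game is a Pareto-optimal solution: if C is an NE, then there is no profile C' such that u_i(C') ≥ u_i(C) for every vertex v_i and u_j(C') > u_j(C) for some vertex v_j. -/

import Mathlib

open Finset

section Defs

variable {V : Type*} [Fintype V] [DecidableEq V] (G : SimpleGraph V) [DecidableRel G.Adj]

/-- The closed neighborhood `N̄ᵢ = Nᵢ ∪ {vᵢ}` of a vertex. -/
def closedNbhd (i : V) : Finset V := insert i (G.neighborFinset i)

/-- The graph has no isolated vertices. -/
def noIsolated : Prop := ∀ v : V, ∃ u : V, G.Adj v u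

/-- `m_j(C) = 1` if no vertex of `N̄_j` has value 2 under `C`, and `0` otherwise. -/
def mval (C : V → Fin 3) (j : V) : ℕ :=
  if ∀ k ∈ closedNbhd G j, C k ≠ 2 then 1 else 0

/-- The utility `u_i(C) = -λ1·c_i² - λ2·Σ_{j ∈ N̄ᵢ} (2 - c_j)·m_j(C)`. -/
def util (lam1 lam2 : ℝ) (C : V → Fin 3) (i : V) : ℝ :=
  -lam1 * ((C i : ℕ) : ℝ) ^ 2
    - lam2 * ∑ j ∈ closedNbhd G i, (2 - ((C j : ℕ) : ℝ)) * (mval G C j : ℝ)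

/-- The potential function `π(C) = -λ1·Σ_j c_j² - λ2·Σ_j (2 - c_j)·m_j(C)`. -/
def pot (lam1 lam2 : ℝ) (C : V → Fin 3) : ℝ :=
  -lam1 * ∑ j : V, ((C j : ℕ) : ℝ) ^ 2
    - lam2 * ∑ j : V, (2 - ((C j : ℕ) : ℝ)) * (mval G C j : ℝ)

/-- `C` is a Nash equilibrium: no unilateral deviation strictly improves a player's utility. -/
def isNE (lam1 lam2 : ℝ) (C : V → Fin 3) : Prop :=
  ∀ (i : V) (c : Fin 3),
    util G lam1 lam2 (Function.update C i c) i ≤ util G lam1 lam2 C i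

/-- `C` is a Roman dominating function. -/
def isRDF (C : V → Fin 3) : Prop :=
  ∀ v : V, C v = 0 → ∃ u : V, G.Adj v u ∧ C u = 2

/-- The weight `γ_R(G,C) = Σ_v C(v)`. -/
def weight (C : V → Fin 3) : ℕ := ∑ v : V, (C v : ℕ)

/-- Decrease a value in `{0,1,2}` by one (truncated at 0). -/
def decr (c : Fin 3) : Fin 3 := ⟨c.val - 1, lt_of_le_of_lt (Nat.sub_le _ _) c.isLt⟩

/-- `C` is a minimal RDF. -/
def isMRDF (C : V → Fin 3) : Prop :=
  isRDF G C ∧ ∀ i : V, 1 ≤ (C i : ℕ) → ¬ isRDF G (Function.update C i (decr (C i)))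

/-- `C` is a strongly minimal RDF. -/
def isSRDF (C : V → Fin 3) : Prop :=
  isMRDF G C ∧
    ¬ ∃ (C' : V → Fin 3) (i : V), isRDF G C' ∧ weight C' < weight C ∧
      C' i = 2 ∧ (∀ j : V, G.Adj i j → C j = 1 → C' j = 0) ∧
      (∀ k : V, k ≠ i → ¬(G.Adj i k ∧ C k = 1) → C' k = C k)

/-- `C` is a global minimum RDF. -/
def isGRDF (C : V → Fin 3) : Prop :=
  isRDF G C ∧ ∀ C' : V → Fin 3, isRDF G C' → weight C ≤ weight C'

/-- `Ñ_j(C)`: white neighbors of `v_j` for which `v_j` is the unique vertex of their closed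
neighborhood with value 2. -/
def tildeN (C : V → Fin 3) (j : V) : Finset V :=
  (G.neighborFinset j).filter
    (fun k => C k = 0 ∧ C j = 2 ∧ ∀ l ∈ closedNbhd G k, C l = 2 → l = j)

/-- `m_{i,j}(C) = 1` iff `Ñ_j(C) ⊆ N_i`. -/
def mij (C : V → Fin 3) (i j : V) : ℕ :=
  if tildeN G C j ⊆ G.neighborFinset i then 1 else 0

/-- `w_i(C) = Σ_{v_j ∈ N_i, c_j = 1} m_j(C) + 2·Σ_{v_j ∈ N_i, c_j = 2} m_{i,j}(C)`. -/
def wval (C : V → Fin 3) (i : V) : ℕ :=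
  ∑ j ∈ (G.neighborFinset i).filter (fun j => C j = 1), mval G C j
    + 2 * ∑ j ∈ (G.neighborFinset i).filter (fun j => C j = 2), mij G C i j

/-- The coalition `τ_i` of the private contract proposed by `v_i`. -/
def coalition (C : V → Fin 3) (i : V) : Finset V :=
  insert i ((G.neighborFinset i).filter
    (fun j => C j = 1 ∨ (C j = 2 ∧ mij G C i j = 1)))

/-- The contract profile: `v_i` takes value 2, the other coalition members take value 0. -/
def contract (C : V → Fin 3) (i : V) : V → Fin 3 :=
  fun k => if k = i then 2 else if k ∈ coalition G C i then 0 else C k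

end Defs

section RomanGame

variable {V : Type*} [Fintype V] [DecidableEq V] {G : SimpleGraph V} [DecidableRel G.Adj]

theorem self_mem_closedNbhd (i : V) : i ∈ closedNbhd G i := by simp [closedNbhd]

theorem mem_closedNbhd_comm {i j : V} : i ∈ closedNbhd G j ↔ j ∈ closedNbhd G i := by
  simp [closedNbhd, eq_comm, G.adj_comm]

theorem mval_eq_zero_or_one (C : V → Fin 3) (j : V) : mval G C j = 0 ∨ mval G C j = 1 := by
  unfold mval
  split_ifs <;> simp

theorem mval_eq_one_iff (C : V → Fin 3) (j : V) :
    mval G C j = 1 ↔ ∀ k ∈ closedNbhd G j, C k ≠ 2 := by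
  unfold mval
  split_ifs with h <;> simpa using h

theorem mval_eq_zero {C : V → Fin 3} {j k : V} (hk : k ∈ closedNbhd G j) (h : C k = 2) :
    mval G C j = 0 :=
  (mval_eq_zero_or_one C j).resolve_right fun h' => (mval_eq_one_iff C j).1 h' k hk h

theorem fin_three_cases (c : Fin 3) : c = 0 ∨ c = 1 ∨ c = 2 := by
  fin_cases c <;> simp

/-- The penalty incurred at `j` by every player of its closed neighborhood. -/
noncomputable def penalty (G : SimpleGraph V) [DecidableRel G.Adj] (C : V → Fin 3) (j : V) : ℝ :=
  (2 - ((C j : ℕ) : ℝ)) * (mval G C j : ℝ)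

theorem util_eq (a b : ℝ) (C : V → Fin 3) (i : V) :
    util G a b C i
      = -a * ((C i : ℕ) : ℝ) ^ 2 - b * ∑ j ∈ closedNbhd G i, penalty G C j := rfl

theorem mval_le_penalty (C : V → Fin 3) (j : V) : (mval G C j : ℝ) ≤ penalty G C j := by
  unfold penalty
  rcases mval_eq_zero_or_one (G := G) C j with h | h
  · simp [h]
  · have h2 := (mval_eq_one_iff C j).1 h j (self_mem_closedNbhd j)
    rcases fin_three_cases (C j) with hc | hc | hc
    · simp [h, hc]
    · simp [h, hc]; norm_num
    · exact absurd hc h2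

theorem penalty_eq_zero {C : V → Fin 3} {j k : V} (hk : k ∈ closedNbhd G j) (h : C k = 2) :
    penalty G C j = 0 := by
  simp [penalty, mval_eq_zero hk h]

theorem util_of_eq_two (a b : ℝ) {C : V → Fin 3} {i : V} (h : C i = 2) :
    util G a b C i = -4 * a := by
  rw [util_eq, Finset.sum_eq_zero fun j hj => penalty_eq_zero (mem_closedNbhd_comm.1 hj) h, h]
  norm_num
  ring

theorem mval_update {C : V → Fin 3} {i : V} {c : Fin 3} (hi : C i ≠ 2) (hc : c ≠ 2) (j : V) :
    mval G (Function.update C i c) j = mval G C j := by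
  have h : ∀ k, Function.update C i c k ≠ 2 ↔ C k ≠ 2 := by
    intro k
    by_cases hk : k = i
    · subst hk; simp [hi, hc]
    · simp [Function.update_of_ne hk]
  simp only [mval, h]

theorem sum_closedNbhd (f : V → ℝ) (i : V) :
    ∑ j ∈ closedNbhd G i, f j = f i + ∑ j ∈ G.neighborFinset i, f j :=
  Finset.sum_insert (by simp)

theorem util_update {a b : ℝ} {C : V → Fin 3} {i : V} {c : Fin 3} (hi : C i ≠ 2) (hc : c ≠ 2) :
    util G a b (Function.update C i c) i
      = util G a b C i + a * (((C i : ℕ) : ℝ) ^ 2 - ((c : ℕ) : ℝ) ^ 2)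
        + b * (((c : ℕ) : ℝ) - ((C i : ℕ) : ℝ)) * (mval G C i : ℝ) := by
  have h : ∑ j ∈ G.neighborFinset i, penalty G (Function.update C i c) j
      = ∑ j ∈ G.neighborFinset i, penalty G C j := by
    refine Finset.sum_congr rfl fun j hj => ?_
    have hji : j ≠ i := by
      rintro rfl
      simp at hj
    simp only [penalty, mval_update hi hc, Function.update_of_ne hji]
  rw [util_eq, util_eq, sum_closedNbhd, sum_closedNbhd, h]
  simp only [penalty, mval_update hi hc, Function.update_self]
  ring

namespace isNE

variable {a b : ℝ} {C : V → Fin 3}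

theorem eq_one_of_mval (hC : isNE G a b C) (hab : a < b) {i : V} (h : mval G C i = 1) :
    C i = 1 := by
  have h2 := (mval_eq_one_iff C i).1 h i (self_mem_closedNbhd i)
  rcases fin_three_cases (C i) with hc | hc | hc
  · have := hC i 1
    rw [util_update h2 (by decide), h, hc] at this
    norm_num at this
    linarith
  · exact hc
  · exact absurd hc h2

theorem mval_of_eq_one (hC : isNE G a b C) (ha : 0 < a) {i : V} (h : C i = 1) :
    mval G C i = 1 := by
  refine (mval_eq_zero_or_one C i).resolve_left fun h0 => ?_
  have := hC i 0
  rw [util_update (by simp [h]) (by decide), h0, h] at this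
  norm_num at this
  linarith

theorem penalty_eq_mval (hC : isNE G a b C) (hab : a < b) (j : V) :
    penalty G C j = mval G C j := by
  rcases mval_eq_zero_or_one (G := G) C j with h | h
  · simp [penalty, h]
  · rw [penalty, hC.eq_one_of_mval hab h, h]
    norm_num

theorem util_ge (hC : isNE G a b C) (i : V) : -4 * a ≤ util G a b C i := by
  rw [← util_of_eq_two (G := G) a b (Function.update_self i (2 : Fin 3) C)]
  exact hC i 2

theorem util_gt_of_ne_two (hC : isNE G a b C) (hl : 2 * b < 3 * a) (hu : 4 * a < 3 * b)
    {i : V} (hi : C i ≠ 2) : -4 * a < util G a b C i := by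
  have hge := hC.util_ge i
  have hab : a < b := by linarith
  have hb : 0 < b := by linarith
  have hs : ∑ j ∈ closedNbhd G i, penalty G C j
      = ((∑ j ∈ closedNbhd G i, mval G C j : ℕ) : ℝ) := by
    push_cast
    exact Finset.sum_congr rfl fun j _ => hC.penalty_eq_mval hab j
  rw [util_eq, hs] at hge ⊢
  set d := ∑ j ∈ closedNbhd G i, mval G C j
  have hd : d ≤ 2 := by
    by_contra! h
    have h3 : (3 : ℝ) ≤ d := by exact_mod_cast h
    have : 0 ≤ a * ((C i : ℕ) : ℝ) ^ 2 := mul_nonneg (by linarith) (sq_nonneg _)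
    nlinarith
  have hd' : (d : ℝ) ≤ 2 := by exact_mod_cast hd
  have hbd := mul_le_mul_of_nonneg_left hd' hb.le
  rcases fin_three_cases (C i) with hc | hc | hc
  · rw [hc]; norm_num; linarith
  · rw [hc]; norm_num; linarith
  · exact absurd hc hi

/-- At an equilibrium, every player with value 2 has a private neighbor of value 0. -/
theorem exists_private (hC : isNE G a b C) (ha : 0 < a) (hb : b < 3 * a) {v : V}
    (hv : C v = 2) :
    ∃ k ∈ closedNbhd G v, C k = 0 ∧ ∀ l ∈ closedNbhd G k, C l = 2 → l = v := by
  by_contra! hno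
  have hz : ∑ j ∈ G.neighborFinset v, penalty G (Function.update C v 1) j = 0 := by
    refine Finset.sum_eq_zero fun j hj => ?_
    have hjv : j ≠ v := by
      rintro rfl
      simp at hj
    have hjm : j ∈ closedNbhd G v := Finset.mem_insert_of_mem hj
    rcases fin_three_cases (C j) with hc | hc | hc
    · obtain ⟨l, hl, hl2, hlv⟩ := hno j hjm hc
      exact penalty_eq_zero hl (by rw [Function.update_of_ne hlv, hl2])
    · have := hC.mval_of_eq_one ha hc
      exact absurd hv ((mval_eq_one_iff C j).1 this v (mem_closedNbhd_comm.1 hjm))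
    · exact penalty_eq_zero (self_mem_closedNbhd j) (by rw [Function.update_of_ne hjv, hc])
  have h := hC v 1
  rw [util_of_eq_two a b hv, util_eq, sum_closedNbhd, hz, penalty, Function.update_self] at h
  rcases mval_eq_zero_or_one (G := G) (Function.update C v 1) v with hm | hm <;>
  · rw [hm] at h
    norm_num at h
    linarith

end isNE

theorem mval_mono {C C' : V → Fin 3} (h : ∀ i, C' i = 2 → C i = 2) (j : V) :
    mval G C j ≤ mval G C' j := by
  rcases mval_eq_zero_or_one (G := G) C j with hm | hm
  · simp [hm]
  · rw [hm, (mval_eq_one_iff C' j).2 fun k hk hk2 => (mval_eq_one_iff C j).1 hm k hk (h k hk2)]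

end RomanGame

/-- Every Nash equilibrium of the Roman domination game is a Pareto-optimal
solution. -/
theorem stmt12 {V : Type*} [Fintype V] [DecidableEq V] (G : SimpleGraph V)
    [DecidableRel G.Adj] (lam1 lam2 : ℝ)
    (h1 : 0 < 2 / 3 * lam2) (h2 : 2 / 3 * lam2 < lam1) (h3 : lam1 < 3 / 4 * lam2)
    (hiso : noIsolated G)
    (C : V → Fin 3) (hNE : isNE G lam1 lam2 C) :
    ¬ ∃ C' : V → Fin 3,
      (∀ i : V, util G lam1 lam2 C i ≤ util G lam1 lam2 C' i) ∧
      (∃ j : V, util G lam1 lam2 C j < util G lam1 lam2 C' j) := by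
  rintro ⟨C', hle, j, hj⟩
  have hb : 0 < lam2 := by linarith
  have ha : 0 < lam1 := by linarith
  have hab : lam1 < lam2 := by linarith
  have hsub : ∀ i, C' i = 2 → C i = 2 := by
    intro i hi
    by_contra hne
    have := hNE.util_gt_of_ne_two (by linarith) (by linarith) hne
    have := hle i
    rw [util_of_eq_two lam1 lam2 hi] at this
    linarith
  have hpen : ∀ k, penalty G C k ≤ penalty G C' k := fun k => by
    rw [hNE.penalty_eq_mval hab]
    exact (Nat.cast_le.2 (mval_mono hsub k)).trans (mval_le_penalty C' k)
  have hsum : ∀ i, ∑ k ∈ closedNbhd G i, penalty G C k ≤ ∑ k ∈ closedNbhd G i, penalty G C' k :=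
    fun i => Finset.sum_le_sum fun k _ => hpen k
  have hsum' : ∀ i, penalty G C i + 1 ≤ penalty G C' i →
      ∑ k ∈ closedNbhd G i, penalty G C k + 1 ≤ ∑ k ∈ closedNbhd G i, penalty G C' k := by
    intro i hi
    rw [sum_closedNbhd, sum_closedNbhd]
    have := Finset.sum_le_sum fun k (_ : k ∈ G.neighborFinset i) => hpen k
    linarith
  have hsup : ∀ v, C v = 2 → C' v = 2 := by
    intro v hv
    by_contra hne
    obtain ⟨k, hkv, hk0, hpriv⟩ := hNE.exists_private ha (by linarith) hv
    have hm' : mval G C' k = 1 := (mval_eq_one_iff C' k).2 fun l hl hl2 =>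
      hne (hpriv l hl (hsub l hl2) ▸ hl2)
    have hp' := mval_le_penalty (G := G) C' k
    rw [hm', Nat.cast_one] at hp'
    have hp : penalty G C k = 0 := penalty_eq_zero (mem_closedNbhd_comm.1 hkv) hv
    have hs := mul_le_mul_of_nonneg_left (hsum' k (by linarith)) hb.le
    have hk := hle k
    rw [util_eq, util_eq, hk0] at hk
    have : 0 ≤ lam1 * ((C' k : ℕ) : ℝ) ^ 2 := by positivity
    norm_num at hk
    linarith
  have hs := mul_le_mul_of_nonneg_left (hsum j) hb.le
  rcases fin_three_cases (C j) with hc | hc | hc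
  · rw [util_eq, util_eq, hc] at hj
    have : 0 ≤ lam1 * ((C' j : ℕ) : ℝ) ^ 2 := by positivity
    norm_num at hj
    linarith
  · rcases fin_three_cases (C' j) with hc' | hc' | hc'
    · have hm := hNE.mval_of_eq_one ha hc
      have hm' : mval G C' j = 1 := by
        have := mval_mono (G := G) hsub j
        rcases mval_eq_zero_or_one (G := G) C' j with h | h <;> omega
      have hs' := mul_le_mul_of_nonneg_left
        (hsum' j (by simp [penalty, hm, hm', hc, hc'])) hb.le
      rw [util_eq, util_eq, hc, hc'] at hj
      norm_num at hj
      linarith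
    · rw [util_eq, util_eq, hc, hc'] at hj
      linarith
    · simp [hsub j hc'] at hc
  · rw [util_of_eq_two lam1 lam2 hc, util_of_eq_two lam1 lam2 (hsup j hc)] at hj
    exact lt_irrefl _ hj
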